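/- Let F: Mod A → Mod A' be an equivalence of categories between module categories of noetherian semiperfect K-algebras. If M is a quasi-Koszul A-module, then F(M) is a quasi-Koszul A'-module. -/

import Mathlib

/- STATEMENT 6: If F : Mod A → Mod A' is an equivalence between module categories of
noetherian semiperfect K-algebras and M is a quasi-Koszul A-module, then F(M) is a
quasi-Koszul A'-module. -/

open CategoryTheory

universe u

noncomputable instance (A : Type u) [Ring A] : HasDerivedCategory (ModuleCat.{u} A) :=
  HasDerivedCategory.standard _

instance (A : Type u) [Ring A] : HasExt.{u+1} (ModuleCat.{u} A) :=
  CategoryTheory.hasExt_of_hasDerivedCategory _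

/-- The Jacobson radical of a ring, as a left ideal. -/
def jacRad (A : Type u) [Ring A] : Ideal A := Ideal.jacobson ⊥

/-- The semisimple quotient `A/J(A)` as a left `A`-module. -/
abbrev ssQuot (A : Type u) [Ring A] : ModuleCat.{u} A :=
  ModuleCat.of A (A ⧸ jacRad A)

/-- A ring is semiperfect if `A/J(A)` is semisimple and idempotents lift
modulo the Jacobson radical. -/
def IsSemiperfectRing (A : Type u) [Ring A] : Prop :=
  IsSemisimpleModule A (A ⧸ jacRad A) ∧
    ∀ a : A, a * a - a ∈ jacRad A →
      ∃ e : A, IsIdempotentElem e ∧ e - a ∈ jacRad A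

/-- Additive span of Yoneda products. -/
noncomputable def extSpan {C : Type (u+1)} [Category C] [Abelian C] [HasExt.{u+1} C]
    (X Y Z : C) (r l : ℕ) : AddSubgroup (Abelian.Ext X Z (r + l)) :=
  AddSubgroup.closure { γ | ∃ (α : Abelian.Ext X Y r) (β : Abelian.Ext Y Z l), γ = α.comp β rfl }

/-- A ring `A` is quasi-Koszul if its Yoneda algebra `Ext^*_A(A/J, A/J)` is generated in
degrees 0 and 1: `Ext^i · Ext^1 = Ext^{i+1}` for all `i ≥ 0`. -/
def IsQuasiKoszul (A : Type u) [Ring A] : Prop :=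
  ∀ i : ℕ, extSpan (ssQuot A) (ssQuot A) (ssQuot A) i 1 = ⊤

/-- An `A`-module `M` is quasi-Koszul if
`Ext^i_A(M, A/J) · Ext^1_A(A/J, A/J) = Ext^{i+1}_A(M, A/J)` for all `i ≥ 0`. -/
def IsQuasiKoszulModule (A : Type u) [Ring A] (M : ModuleCat.{u} A) : Prop :=
  ∀ i : ℕ, extSpan M (ssQuot A) (ssQuot A) i 1 = ⊤


/-- The endomorphisms of `Z` that are sums of morphisms factoring through `Y`. -/
def endThrough {C : Type*} [Category C] [Preadditive C] (Z Y : C) : AddSubgroup (Z ⟶ Z) :=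
  AddSubgroup.closure {f | ∃ (b : Z ⟶ Y) (a : Y ⟶ Z), f = b ≫ a}

lemma comp_mem_endThrough {C : Type*} [Category C] [Preadditive C] {Z Y : C}
    (b : Z ⟶ Y) (a : Y ⟶ Z) : b ≫ a ∈ endThrough Z Y :=
  AddSubgroup.subset_closure ⟨b, a, rfl⟩

/-- An additive functor preserves sums of morphisms factoring through an object. -/
lemma map_mem_endThrough {C D : Type*} [Category C] [Preadditive C] [Category D] [Preadditive D]
    (F : C ⥤ D) [F.Additive] {Z Y : C} {W : D} (e : F.obj Y ≅ W) {f : Z ⟶ Z}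
    (hf : f ∈ endThrough Z Y) : F.map f ∈ endThrough (F.obj Z) W := by
  induction hf using AddSubgroup.closure_induction with
  | mem f hf =>
    obtain ⟨b, a, rfl⟩ := hf
    have h := comp_mem_endThrough (F.map b ≫ e.hom) (e.inv ≫ F.map a)
    simpa using h
  | zero => simp
  | add f g _ _ hf hg => simpa using add_mem hf hg
  | neg f _ hf => simpa using hf

section Span

variable {C : Type (u + 1)} [Category C] [Abelian C] [HasExt.{u + 1} C]

/-- If `𝟙 Z` is a sum of morphisms factoring through `Y`, a subgroup of `Ext X Z n` containing
the images of all classes in `Ext X Y n` is everything. -/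
lemma ext_mem_of_endThrough {X Y Z : C} {n : ℕ} (hZ : 𝟙 Z ∈ endThrough Z Y)
    (H : AddSubgroup (Abelian.Ext X Z n))
    (h : ∀ (γ : Abelian.Ext X Y n) (a : Y ⟶ Z), γ.comp (Abelian.Ext.mk₀ a) (add_zero n) ∈ H)
    (γ : Abelian.Ext X Z n) : γ ∈ H := by
  suffices ∀ f ∈ endThrough Z Y, γ.comp (Abelian.Ext.mk₀ f) (add_zero n) ∈ H by
    simpa using this _ hZ
  intro f hf
  induction hf using AddSubgroup.closure_induction with
  | mem f hf =>
    obtain ⟨b, a, rfl⟩ := hf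
    rw [← Abelian.Ext.mk₀_comp_mk₀, ← Abelian.Ext.comp_assoc_of_third_deg_zero]
    exact h _ a
  | zero => simp
  | add f g _ _ hf hg =>
    rw [Abelian.Ext.mk₀_add, Abelian.Ext.comp_add]
    exact add_mem hf hg
  | neg f _ hf =>
    rw [Abelian.Ext.mk₀_neg, Abelian.Ext.comp_neg]
    exact neg_mem hf

/-- Products passing through `Y` are sums of products passing through `Z` when `𝟙 Y` is a sum of
morphisms factoring through `Z`. -/
lemma comp_mem_extSpan {X Y Z W : C} {r l : ℕ} (hY : 𝟙 Y ∈ endThrough Y Z)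
    (α : Abelian.Ext X Y r) (β : Abelian.Ext Y W l) : α.comp β rfl ∈ extSpan X Z W r l := by
  let φ : Abelian.Ext X Y r →+ Abelian.Ext X W (r + l) :=
    { toFun := fun α => α.comp β rfl
      map_zero' := by simp
      map_add' := by simp }
  refine ext_mem_of_endThrough hY ((extSpan X Z W r l).comap φ) (fun γ a => ?_) α
  refine AddSubgroup.subset_closure ⟨γ, (Abelian.Ext.mk₀ a).comp β (zero_add l), ?_⟩
  exact Abelian.Ext.comp_assoc_of_second_deg_zero _ _ _ _

lemma extSpan_eq_top_of_endThrough {X Y Z : C} {r l : ℕ} (h : extSpan X Y Y r l = ⊤)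
    (hZ : 𝟙 Z ∈ endThrough Z Y) (hY : 𝟙 Y ∈ endThrough Y Z) : extSpan X Z Z r l = ⊤ := by
  refine eq_top_iff.2 fun γ _ => ext_mem_of_endThrough hZ _ (fun γ a => ?_) γ
  have hγ : γ ∈ extSpan X Y Y r l := h ▸ AddSubgroup.mem_top γ
  induction hγ using AddSubgroup.closure_induction with
  | mem γ hγ =>
    obtain ⟨α, β, rfl⟩ := hγ
    rw [Abelian.Ext.comp_assoc_of_third_deg_zero]
    exact comp_mem_extSpan hY _ _
  | zero => simp
  | add f g _ _ hf hg =>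
    rw [Abelian.Ext.add_comp]
    exact add_mem hf hg
  | neg f _ hf =>
    rw [Abelian.Ext.neg_comp]
    exact neg_mem hf

/-- Equivalences of abelian categories with enough projectives preserve the property that
Yoneda products span. -/
lemma extSpan_map_eq_top {D : Type (u + 1)} [Category D] [Abelian D] [HasExt.{u + 1} D]
    [EnoughProjectives C] (F : C ⥤ D) [F.IsEquivalence] [F.Additive] {X Y Z : C} {r l : ℕ}
    (h : extSpan X Y Z r l = ⊤) : extSpan (F.obj X) (F.obj Y) (F.obj Z) r l = ⊤ := by
  have : F.PreservesProjectiveObjects :=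
    ⟨fun {P} hP => F.asEquivalence.map_projective_iff P |>.2 hP⟩
  refine (AddSubgroup.eq_top_iff' _).2 fun γ => ?_
  obtain ⟨γ, rfl⟩ :=
    (F.mapExt_bijective_of_preservesProjectiveObjects X Z (r + l)).surjective γ
  have hγ : γ ∈ extSpan X Y Z r l := h ▸ AddSubgroup.mem_top γ
  induction hγ using AddSubgroup.closure_induction with
  | mem γ hγ =>
    obtain ⟨α, β, rfl⟩ := hγ
    exact AddSubgroup.subset_closure ⟨_, _, Abelian.Ext.mapExactFunctor_comp F α β rfl⟩
  | zero => simp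
  | add f g _ _ hf hg =>
    rw [map_add]
    exact add_mem hf hg
  | neg f _ hf =>
    rw [map_neg]
    exact neg_mem hf

end Span

section Semisimple

variable {A : Type u} [Ring A]

/-- Every simple module is a retract of `A/J` when `A/J` is semisimple. -/
lemma exists_retract_ssQuot (hA : IsSemisimpleModule A (A ⧸ jacRad A)) (T : ModuleCat.{u} A)
    [Simple T] : Nonempty (Retract T (ssQuot A)) := by
  obtain ⟨m, hm, ⟨e⟩⟩ := (isSimpleModule_iff_quot_maximal (R := A) (M := T)).1 inferInstance
  have hle : jacRad A ≤ m := sInf_le ⟨bot_le, hm⟩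
  let p : (A ⧸ jacRad A) →ₗ[A] T := e.symm.toLinearMap ∘ₗ Submodule.factor hle
  have hp : Function.Surjective p := e.symm.surjective.comp (Submodule.factor_surjective hle)
  obtain ⟨i, hi⟩ := IsSemisimpleModule.lifting_property p hp LinearMap.id
  exact ⟨⟨ModuleCat.ofHom i, ModuleCat.ofHom p, by ext1; exact hi⟩⟩

/-- If every simple module is a retract of `Y`, then the identity of `A/J` is a sum of
morphisms factoring through `Y`. -/
lemma id_ssQuot_mem_endThrough (hA : IsSemisimpleModule A (A ⧸ jacRad A)) (Y : ModuleCat.{u} A)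
    (hY : ∀ T : ModuleCat.{u} A, Simple T → Nonempty (Retract T Y)) :
    𝟙 (ssQuot A) ∈ endThrough (ssQuot A) Y := by
  obtain ⟨n, S, e, hS⟩ := IsSemisimpleModule.exists_linearEquiv_fin_dfinsupp A (A ⧸ jacRad A)
  let p (i : Fin n) : ssQuot A ⟶ ModuleCat.of A (S i) :=
    ModuleCat.ofHom (DFinsupp.lapply i ∘ₗ e.toLinearMap)
  let q (i : Fin n) : ModuleCat.of A (S i) ⟶ ssQuot A :=
    ModuleCat.ofHom (e.symm.toLinearMap ∘ₗ DFinsupp.lsingle (M := fun i => S i) i)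
  have hsum : 𝟙 (ssQuot A) = ∑ i, p i ≫ q i := by
    ext
    apply e.injective
    ext1 j
    simp [p, q, ModuleCat.hom_sum, DFinsupp.single_apply]
  rw [hsum]
  refine sum_mem fun i _ => ?_
  have := hS i
  obtain ⟨ρ⟩ := hY (ModuleCat.of A (S i)) inferInstance
  have h := comp_mem_endThrough (p i ≫ ρ.i) (ρ.r ≫ q i)
  simpa using h

/-- For an equivalence `F`, the identity of `A'/J'` is a sum of morphisms factoring through
`F (A/J)`. -/
lemma id_ssQuot_mem_endThrough_of_equivalence {A' : Type u} [Ring A']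
    (hA : IsSemisimpleModule A (A ⧸ jacRad A)) (hA' : IsSemisimpleModule A' (A' ⧸ jacRad A'))
    (F : ModuleCat.{u} A ≌ ModuleCat.{u} A') :
    𝟙 (ssQuot A') ∈ endThrough (ssQuot A') (F.functor.obj (ssQuot A)) := by
  refine id_ssQuot_mem_endThrough hA' _ fun T _ => ?_
  have : Simple (F.inverse.obj T) := simple_obj F.inverse T
  obtain ⟨ρ⟩ := exists_retract_ssQuot hA (F.inverse.obj T)
  exact ⟨(Retract.ofIso (F.counitIso.app T).symm).trans (ρ.map F.functor)⟩

end Semisimple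

theorem stmt6 (K : Type u) [Field K] (A A' : Type u) [Ring A] [Ring A']
    [Algebra K A] [Algebra K A'] [IsNoetherianRing A] [IsNoetherianRing A']
    (hA : IsSemiperfectRing A) (hA' : IsSemiperfectRing A')
    (F : ModuleCat.{u} A ≌ ModuleCat.{u} A')
    (M : ModuleCat.{u} A) (hM : IsQuasiKoszulModule A M) :
    IsQuasiKoszulModule A' (F.functor.obj M) := by
  have : F.functor.Additive := Functor.additive_of_preserves_binary_products _
  intro i
  refine extSpan_eq_top_of_endThrough (extSpan_map_eq_top F.functor (hM i))
    (id_ssQuot_mem_endThrough_of_equivalence hA.1 hA'.1 F) ?_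
  have h := map_mem_endThrough F.functor (F.counitIso.app (ssQuot A'))
    (id_ssQuot_mem_endThrough_of_equivalence hA'.1 hA.1 F.symm)
  simpa using h
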